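/- The sequence I_k^(e) tends to 0 as k tends to infinity if and only if the sequence S_k tends to 0 as k tends to infinity. -/

import Mathlib

/-- Numerators of the modified Farey sequence: at level `k`, order `n` (1-indexed,
`n = 1, …, 2^k + 1`). Level 0 is `0/1, 1/1`; odd orders at level `k+1` are carried
over from level `k`, even orders are mediants. -/
def fareyNum : ℕ → ℕ → ℕ
  | 0, n => if n = 1 then 0 else 1
  | k + 1, m =>
      if m % 2 = 1 then fareyNum k ((m + 1) / 2)
      else fareyNum k (m / 2) + fareyNum k (m / 2 + 1)

/-- Denominators of the modified Farey sequence. -/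
def fareyDen : ℕ → ℕ → ℕ
  | 0, _ => 1
  | k + 1, m =>
      if m % 2 = 1 then fareyDen k ((m + 1) / 2)
      else fareyDen k (m / 2) + fareyDen k (m / 2 + 1)

/-- The Farey fraction `r_k^(n) = n_k^(n) / d_k^(n)` as a real number. -/
noncomputable def fareyR (k n : ℕ) : ℝ := (fareyNum k n : ℝ) / (fareyDen k n : ℝ)

/-- The interval `I_k^(n)`: for `n ≥ 2` it is `r_k^(2n) - r_k^(2n-2)`, and
`I_k^(1) := 2/(k+1)`. -/
noncomputable def fareyI (k n : ℕ) : ℝ :=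
  if n = 1 then 2 / ((k : ℝ) + 1) else fareyR k (2 * n) - fareyR k (2 * n - 2)

/-- Total length of even intervals at level `k`. -/
noncomputable def fareyIe (k : ℕ) : ℝ :=
  ∑ i ∈ Finset.Icc 1 (2 ^ (k - 2)), fareyI k (2 * i)

/-- Total length of odd intervals at level `k`. -/
noncomputable def fareyIo (k : ℕ) : ℝ :=
  ∑ i ∈ Finset.Icc 1 (2 ^ (k - 2)), fareyI k (2 * i - 1)

/-- `S_k`: the sum of inverse squares of the new denominators at level `k`. -/
noncomputable def fareyS (k : ℕ) : ℝ :=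
  ∑ n ∈ Finset.Icc 1 (2 ^ (k - 1)), 1 / (fareyDen k (2 * n) : ℝ) ^ 2

theorem fareyNum_succ_odd (k n : ℕ) : fareyNum (k + 1) (2 * n + 1) = fareyNum k (n + 1) := by
  rw [fareyNum, if_pos (by omega)]
  congr 1
  omega

theorem fareyDen_succ_odd (k n : ℕ) : fareyDen (k + 1) (2 * n + 1) = fareyDen k (n + 1) := by
  rw [fareyDen, if_pos (by omega)]
  congr 1
  omega

theorem fareyNum_succ_even (k n : ℕ) :
    fareyNum (k + 1) (2 * n) = fareyNum k n + fareyNum k (n + 1) := by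
  rw [fareyNum, if_neg (by omega), Nat.mul_div_cancel_left n two_pos]

theorem fareyDen_succ_even (k n : ℕ) :
    fareyDen (k + 1) (2 * n) = fareyDen k n + fareyDen k (n + 1) := by
  rw [fareyDen, if_neg (by omega), Nat.mul_div_cancel_left n two_pos]

theorem fareyDen_pos (k n : ℕ) : 0 < fareyDen k n := by
  induction k generalizing n with
  | zero => simp [fareyDen]
  | succ k ih =>
    rw [fareyDen]
    split_ifs
    · exact ih _
    · exact Nat.add_pos_left (ih _) _

/-- Consecutive Farey fractions have determinant one. -/
theorem fareyNum_mul_fareyDen (k n : ℕ) (hn : n < 2 ^ k) :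
    fareyNum k (n + 2) * fareyDen k (n + 1) = fareyNum k (n + 1) * fareyDen k (n + 2) + 1 := by
  induction k generalizing n with
  | zero =>
    obtain rfl : n = 0 := by simpa using hn
    simp [fareyNum, fareyDen]
  | succ k ih =>
    rw [pow_succ] at hn
    obtain ⟨m, rfl | rfl⟩ := Nat.even_or_odd' n
    · have h := ih m (by omega)
      rw [show 2 * m + 2 = 2 * (m + 1) by ring, fareyNum_succ_even, fareyDen_succ_even,
        fareyNum_succ_odd, fareyDen_succ_odd, add_assoc m 1 1]
      linarith
    · have h := ih m (by omega)
      rw [show 2 * m + 1 + 2 = 2 * (m + 1) + 1 by ring, show 2 * m + 1 + 1 = 2 * (m + 1) by ring,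
        fareyNum_succ_even, fareyDen_succ_even, fareyNum_succ_odd, fareyDen_succ_odd,
        add_assoc m 1 1]
      linarith

/-- The length of an even interval in terms of the denominators of the two parents of the
fraction it surrounds. -/
theorem fareyI_even (k n : ℕ) (hn : n < 2 ^ k) :
    fareyI (k + 2) (2 * (n + 1)) =
      3 / (((fareyDen k (n + 1) : ℝ) + 2 * fareyDen k (n + 2)) *
        (2 * (fareyDen k (n + 1) : ℝ) + fareyDen k (n + 2))) := by
  have hdet : (fareyNum k (n + 2) : ℝ) * fareyDen k (n + 1) =
      fareyNum k (n + 1) * fareyDen k (n + 2) + 1 := by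
    exact_mod_cast fareyNum_mul_fareyDen k n hn
  have hp : (0 : ℝ) < fareyDen k (n + 1) := by exact_mod_cast fareyDen_pos k (n + 1)
  have hq : (0 : ℝ) < fareyDen k (n + 2) := by exact_mod_cast fareyDen_pos k (n + 2)
  rw [fareyI, if_neg (by omega),
    show 2 * (2 * (n + 1)) - 2 = 2 * (2 * n + 1) by omega]
  simp only [fareyR, fareyNum_succ_even (k + 1), fareyDen_succ_even (k + 1), fareyNum_succ_odd,
    fareyDen_succ_odd, show 2 * n + 1 + 1 = 2 * (n + 1) by ring, fareyNum_succ_even,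
    fareyDen_succ_even, show n + 1 + 1 = n + 2 by ring]
  push_cast
  rw [div_sub_div _ _ (by positivity) (by positivity),
    div_eq_div_iff (by positivity) (by positivity)]
  linear_combination 3 * ((fareyDen k (n + 1) : ℝ) + 2 * fareyDen k (n + 2)) *
        (2 * (fareyDen k (n + 1) : ℝ) + fareyDen k (n + 2)) * hdet

theorem one_div_sq_le_fareyI_even (k n : ℕ) (hn : n < 2 ^ k) :
    1 / (fareyDen (k + 1) (2 * (n + 1)) : ℝ) ^ 2 ≤ fareyI (k + 2) (2 * (n + 1)) := by
  have hp : (0 : ℝ) < fareyDen k (n + 1) := by exact_mod_cast fareyDen_pos k (n + 1)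
  have hq : (0 : ℝ) < fareyDen k (n + 2) := by exact_mod_cast fareyDen_pos k (n + 2)
  rw [fareyI_even k n hn, fareyDen_succ_even, Nat.cast_add,
    div_le_div_iff₀ (by positivity) (by positivity)]
  nlinarith [sq_nonneg ((fareyDen k (n + 1) : ℝ) - fareyDen k (n + 2)), mul_pos hp hq]

theorem fareyI_even_le (k n : ℕ) (hn : n < 2 ^ k) :
    fareyI (k + 2) (2 * (n + 1)) ≤ 2 * (1 / (fareyDen (k + 1) (2 * (n + 1)) : ℝ) ^ 2) := by
  have hp : (0 : ℝ) < fareyDen k (n + 1) := by exact_mod_cast fareyDen_pos k (n + 1)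
  have hq : (0 : ℝ) < fareyDen k (n + 2) := by exact_mod_cast fareyDen_pos k (n + 2)
  rw [fareyI_even k n hn, fareyDen_succ_even, Nat.cast_add, mul_one_div,
    div_le_div_iff₀ (by positivity) (by positivity)]
  nlinarith [mul_pos hp hq]

theorem fareyS_nonneg (k : ℕ) : 0 ≤ fareyS k :=
  Finset.sum_nonneg fun _ _ => by positivity

theorem fareyS_le_fareyIe (k : ℕ) : fareyS (k + 1) ≤ fareyIe (k + 2) := by
  refine Finset.sum_le_sum fun i hi => ?_
  obtain ⟨h1, h2⟩ := Finset.mem_Icc.1 hi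
  obtain ⟨n, rfl⟩ := Nat.exists_eq_add_of_le' h1
  exact one_div_sq_le_fareyI_even k n h2

theorem fareyIe_le_two_mul_fareyS (k : ℕ) : fareyIe (k + 2) ≤ 2 * fareyS (k + 1) := by
  rw [fareyS, Finset.mul_sum]
  refine Finset.sum_le_sum fun i hi => ?_
  obtain ⟨h1, h2⟩ := Finset.mem_Icc.1 hi
  obtain ⟨n, rfl⟩ := Nat.exists_eq_add_of_le' h1
  exact fareyI_even_le k n h2

/-- `I_k^(e) → 0` as `k → ∞` if and only if `S_k → 0` as `k → ∞`. -/
theorem fareyIe_tendsto_zero_iff_fareyS_tendsto_zero :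
    Filter.Tendsto (fun k : ℕ => fareyIe k) Filter.atTop (nhds 0) ↔
      Filter.Tendsto (fun k : ℕ => fareyS k) Filter.atTop (nhds 0) := by
  rw [← Filter.tendsto_add_atTop_iff_nat 2, ← Filter.tendsto_add_atTop_iff_nat (f := fareyS) 1]
  refine ⟨fun h => squeeze_zero (fun k => fareyS_nonneg _) fareyS_le_fareyIe h, fun h => ?_⟩
  exact squeeze_zero (fun k => (fareyS_nonneg _).trans (fareyS_le_fareyIe k))
    fareyIe_le_two_mul_fareyS (by simpa using h.const_mul 2)
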